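/- arXiv:2601.22339 — 2 statements merged into one kernel-verified Lean document; each statement's English description precedes it below -/
import Mathlib

section
/- Approximate reachability under bounded noise: in the Schrödinger propagator setting with noisy perturbation, suppose the ideal (noise-free) control protocol drives a unit initial state exactly to the target at time T > 0, i.e. U(T) ψ_init = ψ_target with ‖ψ_init‖ = 1. Then for every ε > 0 there exists δ_max > 0 (for instance δ_max = ε / T) such that whenever ‖Δ(t)‖ ≤ δ_max for all t ∈ [0, T], the noisy final state ψ(T) = V(T) ψ_init satisfies ‖ψ(T) − ψ_target‖ ≤ ε. -/
open Matrix
open scoped Matrix.Norms.L2Operator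

theorem prop_unitary_aux {d : ℕ} (H U : ℝ → Matrix (Fin d) (Fin d) ℂ)
    (hHherm : ∀ t, (H t)ᴴ = H t)
    (hU : ∀ t, HasDerivAt U (-(Complex.I • (H t * U t))) t)
    (hU0 : U 0 = 1) (t : ℝ) : U t ∈ unitary (Matrix (Fin d) (Fin d) ℂ) := by
  have hder : ∀ s, HasDerivAt (fun s => star (U s) * U s) 0 s := by
    intro s
    have h := (hU s).star.mul (hU s)
    refine h.congr_deriv ?_
    have hs : star (H s) = H s := hHherm s
    simp [hs, mul_assoc]
  have hc : star (U t) * U t = 1 := by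
    have := is_const_of_deriv_eq_zero (fun s => (hder s).differentiableAt)
      (fun s => (hder s).deriv) t 0
    simpa [hU0] using this
  exact Unitary.mem_iff.2 ⟨hc, mul_eq_one_comm.1 hc⟩

/-- **Approximate reachability under bounded noise.**
In the Schrödinger propagator setting, suppose the ideal control protocol drives a unit
initial state exactly to the target at time `T > 0`, i.e. `U T ψinit = ψtarget` with
`‖ψinit‖ = 1`.  Then for every `ε > 0` there exists `δmax > 0` such that whenever the
noise satisfies `‖Δ t‖ ≤ δmax` on `[0, T]`, the noisy final state `ψ(T) = V T ψinit`
satisfies `‖ψ(T) - ψtarget‖ ≤ ε`. -/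
theorem approximate_reachability_under_noise (d : ℕ) (hd : 1 ≤ d)
    (H U : ℝ → Matrix (Fin d) (Fin d) ℂ)
    (hHcont : Continuous H)
    (hHherm : ∀ t, (H t)ᴴ = H t)
    (hU : ∀ t, HasDerivAt U (-(Complex.I • (H t * U t))) t)
    (hU0 : U 0 = 1)
    (T : ℝ) (hT : 0 < T)
    (ψinit ψtarget : EuclideanSpace ℂ (Fin d))
    (hinit : ‖ψinit‖ = 1)
    (htarget : Matrix.toEuclideanLin (U T) ψinit = ψtarget) :
    ∀ ε > (0 : ℝ), ∃ δmax > (0 : ℝ),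
      ∀ Δ V : ℝ → Matrix (Fin d) (Fin d) ℂ,
        Continuous Δ →
        (∀ t, (Δ t)ᴴ = Δ t) →
        (∀ t, HasDerivAt V (-(Complex.I • ((H t + Δ t) * V t))) t) →
        V 0 = 1 →
        (∀ t ∈ Set.Icc (0 : ℝ) T, ‖Δ t‖ ≤ δmax) →
        ‖Matrix.toEuclideanLin (V T) ψinit - ψtarget‖ ≤ ε := by
  intro ε hε
  refine ⟨ε / T, by positivity, ?_⟩
  intro Δ V hΔc hΔ hV hV0 hb
  have uU := prop_unitary_aux H U hHherm hU hU0
  have uV := prop_unitary_aux (fun t => H t + Δ t) V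
    (fun t => by simp [hHherm t, hΔ t]) hV hV0
  have hder : ∀ s, HasDerivAt (fun s => star (U s) * V s)
      (star (U s) * ((-Complex.I) • Δ s * V s)) s := by
    intro s
    have h := (hU s).star.mul (hV s)
    refine h.congr_deriv ?_
    have hs : star (H s) = H s := hHherm s
    simp [hs, mul_assoc, add_mul, mul_add]
  have key := norm_image_sub_le_of_norm_deriv_le_segment' (a := 0) (b := T) (C := ε / T)
    (fun s _ => (hder s).hasDerivWithinAt) (by
      intro s hs
      rw [CStarRing.norm_mem_unitary_mul _ (Unitary.star_mem (uU s)),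
        CStarRing.norm_mul_mem_unitary _ (uV s), norm_smul]
      simpa using hb s ⟨hs.1, hs.2.le⟩) T ⟨hT.le, le_rfl⟩
  have e : U T * (star (U T) * V T - star (U 0) * V 0) = V T - U T := by
    rw [hU0, hV0, mul_sub, ← mul_assoc, Unitary.mul_star_self_of_mem (uU T)]
    simp
  have hn : ‖V T - U T‖ ≤ ε := by
    rw [← e, CStarRing.norm_mem_unitary_mul _ (uU T)]
    refine key.trans (le_of_eq ?_)
    field_simp
    simp
  rw [← htarget, ← LinearMap.sub_apply, ← map_sub]
  refine (Matrix.l2_opNorm_mulVec (V T - U T) ψinit).trans ?_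
  rw [hinit, mul_one]
  exact hn
end

section
/- Noise-resilient fidelity guarantee: in the Schrödinger propagator setting with noisy perturbation, suppose the ideal control protocol drives a unit initial state exactly to a unit target state at time T > 0, i.e. U(T) ψ_init = ψ_target with ‖ψ_init‖ = ‖ψ_target‖ = 1, and that ‖Δ(t)‖ ≤ δ_max for all t ∈ [0, T]. Then the noisy final state ψ(T) = V(T) ψ_init achieves fidelity F(ψ(T), ψ_target) = |⟨ψ_target, ψ(T)⟩|² ≥ 1 − (δ_max · T)². -/
open Matrix
open scoped Matrix.Norms.L2Operator ComplexInnerProductSpace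

theorem aux_unitary (d : ℕ) (H U : ℝ → Matrix (Fin d) (Fin d) ℂ)
    (hH : ∀ t, (H t)ᴴ = H t)
    (hU : ∀ t, HasDerivAt U (-(Complex.I • (H t * U t))) t)
    (hU0 : U 0 = 1) (t : ℝ) : U t ∈ unitary (Matrix (Fin d) (Fin d) ℂ) := by
  have h1 : ∀ t, HasDerivAt (fun t => star (U t) * U t) 0 t := by
    intro t
    have h := (hU t).star.mul (hU t)
    refine h.congr_deriv ?_
    simp [star_eq_conjTranspose, Matrix.conjTranspose_mul, hH, mul_assoc]
  have h2 : star (U t) * U t = 1 := by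
    have := is_const_of_deriv_eq_zero (fun t => (h1 t).differentiableAt)
      (fun t => (h1 t).deriv) t 0
    simpa [hU0] using this
  exact Unitary.mem_iff.2 ⟨h2, mul_eq_one_comm.1 h2⟩

theorem aux_inner (d : ℕ) (A B : Matrix (Fin d) (Fin d) ℂ) (x : EuclideanSpace ℂ (Fin d)) :
    ⟪Matrix.toEuclideanLin A x, Matrix.toEuclideanLin B x⟫
      = ⟪x, Matrix.toEuclideanLin (star A * B) x⟫ := by
  rw [← LinearMap.adjoint_inner_right, ← Matrix.toEuclideanLin_conjTranspose_eq_adjoint]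
  congr 1
  simp [Matrix.toEuclideanLin_apply, star_eq_conjTranspose, Matrix.mulVec_mulVec]

theorem aux_norm (d : ℕ) (A : Matrix (Fin d) (Fin d) ℂ)
    (hA : A ∈ unitary (Matrix (Fin d) (Fin d) ℂ)) (x : EuclideanSpace ℂ (Fin d)) :
    ‖Matrix.toEuclideanLin A x‖ = ‖x‖ := by
  have h := aux_inner d A A x
  rw [(Unitary.mem_iff.1 hA).1, inner_self_eq_norm_sq_to_K] at h
  have h1 : Matrix.toEuclideanLin (1 : Matrix (Fin d) (Fin d) ℂ) x = x := by
    simp [Matrix.toEuclideanLin_apply]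
  rw [h1, inner_self_eq_norm_sq_to_K] at h
  have h2 : ‖Matrix.toEuclideanLin A x‖ ^ 2 = ‖x‖ ^ 2 := by exact_mod_cast h
  exact (sq_eq_sq₀ (norm_nonneg _) (norm_nonneg _)).1 h2

/-- **Noise-resilient fidelity guarantee.**
In the Schrödinger propagator setting with noisy perturbation, suppose the ideal control
protocol drives a unit initial state exactly to a unit target state at time `T > 0`,
i.e. `U T ψinit = ψtarget` with `‖ψinit‖ = ‖ψtarget‖ = 1`, and `‖Δ t‖ ≤ δmax` on `[0, T]`.
Then the noisy final state `ψ(T) = V T ψinit` achieves fidelity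
`F(ψ(T), ψtarget) = |⟪ψtarget, ψ(T)⟫|² ≥ 1 - (δmax * T)²`. -/
theorem noise_resilient_fidelity_guarantee (d : ℕ) (hd : 1 ≤ d)
    (H U Δ V : ℝ → Matrix (Fin d) (Fin d) ℂ)
    (hHcont : Continuous H)
    (hHherm : ∀ t, (H t)ᴴ = H t)
    (hU : ∀ t, HasDerivAt U (-(Complex.I • (H t * U t))) t)
    (hU0 : U 0 = 1)
    (hΔcont : Continuous Δ)
    (hΔherm : ∀ t, (Δ t)ᴴ = Δ t)
    (hV : ∀ t, HasDerivAt V (-(Complex.I • ((H t + Δ t) * V t))) t)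
    (hV0 : V 0 = 1)
    (T δmax : ℝ) (hT : 0 < T)
    (hΔbound : ∀ t ∈ Set.Icc (0 : ℝ) T, ‖Δ t‖ ≤ δmax)
    (ψinit ψtarget : EuclideanSpace ℂ (Fin d))
    (hinit : ‖ψinit‖ = 1) (htargetnorm : ‖ψtarget‖ = 1)
    (htarget : Matrix.toEuclideanLin (U T) ψinit = ψtarget) :
    1 - (δmax * T) ^ 2 ≤
      ‖⟪ψtarget, Matrix.toEuclideanLin (V T) ψinit⟫‖ ^ 2 := by
  have hUu := aux_unitary d H U hHherm hU hU0
  have hVu := aux_unitary d (fun t => H t + Δ t) V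
    (fun t => by simp [Matrix.conjTranspose_add, hHherm, hΔherm]) hV hV0
  have hW : ∀ t, HasDerivAt (fun t => star (U t) * V t)
      (-(Complex.I • (star (U t) * (Δ t * V t)))) t := by
    intro t
    have h := (hU t).star.mul (hV t)
    refine h.congr_deriv ?_
    simp [star_eq_conjTranspose, Matrix.conjTranspose_mul, hHherm, mul_assoc, add_mul, mul_add]
  have hb : ‖star (U T) * V T - 1‖ ≤ δmax * T := by
    have h := norm_image_sub_le_of_norm_deriv_le_segment' (a := 0) (b := T) (C := δmax)
      (fun t _ => (hW t).hasDerivWithinAt) (fun t ht => by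
        rw [norm_neg, norm_smul, Complex.norm_I, one_mul]
        have e1 := CStarRing.norm_mem_unitary_mul (Δ t * V t) (Unitary.star_mem (hUu t))
        have e2 := CStarRing.norm_mul_mem_unitary (Δ t) (hVu t)
        rw [e1, e2]
        exact hΔbound t ⟨ht.1, ht.2.le⟩) T ⟨hT.le, le_rfl⟩
    simpa [hU0, hV0] using h
  have hdiff : ‖Matrix.toEuclideanLin (V T) ψinit - ψtarget‖ ≤ δmax * T := by
    have e : V T - U T = U T * (star (U T) * V T - 1) := by
      rw [mul_sub, ← mul_assoc, (Unitary.mem_iff.1 (hUu T)).2, one_mul, mul_one]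
    have e2 : ‖V T - U T‖ ≤ δmax * T := by
      rw [e, CStarRing.norm_mem_unitary_mul _ (hUu T)]
      exact hb
    rw [← htarget, ← LinearMap.sub_apply, ← map_sub]
    have := Matrix.l2_opNorm_mulVec (V T - U T) ψinit
    rw [hinit, mul_one] at this
    exact this.trans e2
  have hn : ‖Matrix.toEuclideanLin (V T) ψinit‖ = 1 := by
    rw [aux_norm d _ (hVu T), hinit]
  have hsq := norm_sub_sq (𝕜 := ℂ) ψtarget (Matrix.toEuclideanLin (V T) ψinit)
  rw [norm_sub_rev, hn, htargetnorm] at hsq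
  have hre := Complex.re_le_norm ⟪ψtarget, Matrix.toEuclideanLin (V T) ψinit⟫
  simp only [RCLike.re_to_complex] at hsq
  have h0 := norm_nonneg (Matrix.toEuclideanLin (V T) ψinit - ψtarget)
  have hx := pow_le_pow_left₀ h0 hdiff 2
  set r := ‖⟪ψtarget, Matrix.toEuclideanLin (V T) ψinit⟫‖
  have hr : 1 - (δmax * T) ^ 2 / 2 ≤ r := by linarith
  nlinarith [sq_nonneg (r - 1)]
end
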